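/- Let X, W be countable sets, 𝒜 = 2^(X), φ an 𝒜-gauge on W with φ(w,w) = ∅, and (X, μ) a measured walls structure such that d_μ is proper. Define κ̃ on W × X by κ̃((w₁,x₁),(w₂,x₂)) = μ({A ⊆ X : A ⊢ φ(w₁,w₂) ∪ {x₁,x₂}}). Let u be a conditionally negative definite kernel on W such that for every finite F ⊆ X and every w′ ∈ W, the restriction of u to the set {w ∈ W : φ(w′,w) ⊆ F} is proper. Then the kernel ((w₁,x₁),(w₂,x₂)) ↦ κ̃((w₁,x₁),(w₂,x₂)) + u(w₁,w₂) is a proper kernel on W × X. -/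

import Mathlib

open MeasureTheory Function Set
open scoped ENNReal
/-- A conditionally negative definite kernel: symmetric, vanishing on the diagonal,
with `∑ᵢⱼ cᵢcⱼ κ(xᵢ,xⱼ) ≤ 0` whenever `∑ᵢ cᵢ = 0`. -/
def IsCNDKernel {X : Type*} (κ : X → X → ℝ) : Prop :=
  (∀ x y, κ x y = κ y x) ∧ (∀ x, κ x x = 0) ∧
    ∀ (n : ℕ) (x : Fin n → X) (c : Fin n → ℝ), (∑ i, c i) = 0 →
      ∑ i, ∑ j, c i * c j * κ (x i) (x j) ≤ 0

/-- A conditionally negative definite function on a group. -/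
def IsCNDFunction {G : Type*} [Group G] (ψ : G → ℝ) : Prop :=
  IsCNDKernel fun g h => ψ (g⁻¹ * h)

/-- A proper function on a group: sublevel sets are finite. -/
def IsProperFunction {G : Type*} [Group G] (ψ : G → ℝ) : Prop :=
  ∀ R : ℝ, {g : G | ψ g ≤ R}.Finite
/-- A Borel measure on the power set `2^X`, identified with `X → Bool` endowed with the
product topology (and its Borel σ-algebra). -/
noncomputable abbrev WallMeasure (X : Type*) := @MeasureTheory.Measure (X → Bool) (borel _)

/-- The pseudo-distance associated to a wall measure:
`d_μ(x,y) = μ {A | exactly one of x, y belongs to A}`. -/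
def wallDist {X : Type*} (μ : WallMeasure X) (x y : X) : ℝ≥0∞ :=
  μ {A | A x ≠ A y}

/-- A measured walls structure: all wall pseudo-distances are finite. -/
def IsMWS {X : Type*} (μ : WallMeasure X) : Prop :=
  ∀ x y : X, wallDist μ x y < ⊤

/-- Pushforward of wall measures. -/
noncomputable def wallMap {X Y : Type*} (f : (X → Bool) → (Y → Bool)) (μ : WallMeasure X) :
    WallMeasure Y :=
  @MeasureTheory.Measure.map _ _ (borel _) (borel _) f μ

/-- Left invariance of a wall measure on a group, for the action `(k·A)(x) = A(k⁻¹x)`. -/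
def IsLeftInvariantWalls {K : Type*} [Group K] (μ : WallMeasure K) : Prop :=
  ∀ k : K, wallMap (fun A x => A (k⁻¹ * x)) μ = μ

/-- `A ⊢ F` : the half-space `A` cuts the subset `F`, i.e. `F` is neither contained in `A`
nor in its complement. -/
def CutsB {X : Type*} (A : X → Bool) (F : Set X) : Prop :=
  (∃ x ∈ F, A x = true) ∧ (∃ x ∈ F, A x = false)
/-- The lifted kernel on `W × X`:
`κ̃((w₁,x₁),(w₂,x₂)) = μ {A | A ⊢ φ(w₁,w₂) ∪ {x₁,x₂}}`. -/
noncomputable def liftedKernel {X W : Type*} (φ : W → W → Finset X) (μ : WallMeasure X)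
    (p q : W × X) : ℝ≥0∞ :=
  μ {A | CutsB A ((φ p.1 q.1 : Set X) ∪ {p.2, q.2})}

theorem IsCNDKernel.nonneg {X : Type*} {κ : X → X → ℝ} (h : IsCNDKernel κ) (x y : X) :
    0 ≤ κ x y := by
  have h2 := h.2.2 2 ![x, y] ![1, -1] (by simp)
  simp only [Fin.sum_univ_two, Matrix.cons_val_zero, Matrix.cons_val_one, h.2.1, h.1 y x] at h2
  linarith

/-- If `d_μ` is finite, then finite sets are cut by finitely much measure. -/
theorem IsMWS.measure_cutsB_lt_top {X : Type*} {μ : WallMeasure X} (hμ : IsMWS μ)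
    {F : Set X} (hF : F.Finite) {x : X} : μ {A | CutsB A F} < ⊤ := by
  let _ : MeasurableSpace (X → Bool) := borel _
  refine lt_of_le_of_lt (measure_mono (t := ⋃ y ∈ F, {A : X → Bool | A x ≠ A y}) ?_)
    (measure_biUnion_lt_top hF fun y _ => hμ x y)
  rintro A ⟨⟨y, hy, hAy⟩, z, hz, hAz⟩
  simp only [mem_iUnion, mem_ofPred_eq, exists_prop]
  cases hx : A x
  · exact ⟨y, hy, by simp [hAy]⟩
  · exact ⟨z, hz, by simp [hAz]⟩

theorem wallDist_le_measure_cutsB {X : Type*} (μ : WallMeasure X) {F : Set X} {x y : X}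
    (hx : x ∈ F) (hy : y ∈ F) : wallDist μ x y ≤ μ {A | CutsB A F} := by
  let _ : MeasurableSpace (X → Bool) := borel _
  refine measure_mono fun A (hA : A x ≠ A y) => ?_
  cases hAx : A x
  · exact ⟨⟨y, hy, by simpa [hAx] using hA⟩, x, hx, hAx⟩
  · exact ⟨⟨x, hx, hAx⟩, y, hy, by simpa [hAx] using hA⟩

open scoped Classical in
/-- **Proposition.** If `d_μ` is proper and the conditionally negative definite kernel `u`
on `W` is proper in restriction to every set `{w | φ(w′,w) ⊆ F}` (`F` finite), then the
kernel `κ̃ + u` is proper on `W × X`. -/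
theorem lifted_kernel_plus_u_proper {X W : Type*} [Countable X] [Countable W]
    (φ : W → W → Finset X)
    (hsymm : ∀ w w', φ w w' = φ w' w)
    (htri : ∀ w w' w'', φ w w'' ⊆ φ w w' ∪ φ w' w'')
    (hdiag : ∀ w, φ w w = ∅)
    (μ : WallMeasure X) (hμ : IsMWS μ)
    (hprop : ∀ (x : X) (r : ℝ≥0∞), r ≠ ⊤ → {y : X | wallDist μ x y ≤ r}.Finite)
    (u : W → W → ℝ) (hu : IsCNDKernel u)
    (huprop : ∀ (F : Finset X) (w' w₀ : W), (φ w' w₀ : Set X) ⊆ (F : Set X) →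
      ∀ R : ℝ, {w : W | (φ w' w : Set X) ⊆ (F : Set X) ∧ u w₀ w ≤ R}.Finite) :
    ∀ (p : W × X) (R : ℝ),
      {q : W × X | (liftedKernel φ μ p q).toReal + u p.1 q.1 ≤ R}.Finite := by
  rintro ⟨w, x⟩ R
  have hF := hprop x (ENNReal.ofReal R) ENNReal.ofReal_ne_top
  refine ((huprop hF.toFinset w w (by simp [hdiag]) R).prod hF).subset ?_
  rintro ⟨w', x'⟩ hq
  simp only [mem_ofPred_eq] at hq
  have hfin : liftedKernel φ μ (w, x) (w', x') ≠ ⊤ :=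
    (hμ.measure_cutsB_lt_top (x := x)
      ((φ w w').finite_toSet.union (Set.toFinite {x, x'}))).ne
  have hk : liftedKernel φ μ (w, x) (w', x') ≤ ENNReal.ofReal R :=
    ENNReal.le_ofReal_iff_toReal_le hfin
      (by linarith [hu.nonneg w w',
        ENNReal.toReal_nonneg (a := liftedKernel φ μ (w, x) (w', x'))]) |>.2
      (by linarith [hu.nonneg w w'])
  have hball : ∀ y ∈ (φ w w' : Set X) ∪ {x, x'}, wallDist μ x y ≤ ENNReal.ofReal R :=
    fun y hy => (wallDist_le_measure_cutsB μ (by simp) hy).trans hk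
  refine ⟨⟨fun y hy => ?_, ?_⟩, hball x' (by simp)⟩
  · simpa using hball y (Or.inl hy)
  · exact (le_add_of_nonneg_left ENNReal.toReal_nonneg).trans hq
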